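/- Let O be a residually finite principal ideal domain with fraction field K, a ∈ O nonzero, and U a K-subspace of K^ℓ. Then #(π(U)[a]) = N(⟨a⟩)^{dim_K U}, where π(U)[a] is the a-torsion submodule of π(U) and N(⟨a⟩) = #(O/⟨a⟩). -/

import Mathlib

noncomputable section

/-- The image of `O` in `K` as an `O`-submodule. -/
def OinK (O K : Type*) [CommRing O] [CommRing K] [Algebra O K] : Submodule O K :=
  LinearMap.range (Algebra.linearMap O K)

/-- The coordinatewise canonical projection `π : K^ℓ → (K/O)^ℓ`. -/
def piMap (O K : Type*) [CommRing O] [CommRing K] [Algebra O K] (ℓ : ℕ) :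
    (Fin ℓ → K) →ₗ[O] (Fin ℓ → K ⧸ OinK O K) :=
  LinearMap.pi fun i => (OinK O K).mkQ.comp (LinearMap.proj i)

/-- The image `π(U)` of a `K`-subspace `U ⊆ K^ℓ` under `π`, as an `O`-submodule of `(K/O)^ℓ`. -/
def piU (O : Type*) {K : Type*} [CommRing O] [CommRing K] [Algebra O K] {ℓ : ℕ}
    (U : Submodule K (Fin ℓ → K)) : Submodule O (Fin ℓ → K ⧸ OinK O K) :=
  (U.restrictScalars O).map (piMap O K ℓ)

/-- The lattice of integral vectors of `U`. -/
def latL (O : Type*) {K : Type*} [CommRing O] [CommRing K] [Algebra O K] {ℓ : ℕ}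
    (U : Submodule K (Fin ℓ → K)) : Submodule O (Fin ℓ → K) :=
  U.restrictScalars O ⊓ LinearMap.ker (piMap O K ℓ)

lemma piMap_eq_zero_iff {O K : Type*} [CommRing O] [CommRing K] [Algebra O K] {ℓ : ℕ}
    (x : Fin ℓ → K) : piMap O K ℓ x = 0 ↔ ∀ i, ∃ r : O, algebraMap O K r = x i := by
  rw [funext_iff]
  refine forall_congr' fun i => ?_
  change (OinK O K).mkQ (x i) = 0 ↔ _
  rw [Submodule.mkQ_apply, Submodule.Quotient.mk_eq_zero]
  rfl

lemma mem_latL {O K : Type*} [CommRing O] [CommRing K] [Algebra O K] {ℓ : ℕ}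
    (U : Submodule K (Fin ℓ → K)) (x : Fin ℓ → K) :
    x ∈ latL O U ↔ x ∈ U ∧ piMap O K ℓ x = 0 := Iff.rfl

lemma latL_noeth {O K : Type*} [CommRing O] [IsNoetherianRing O] [CommRing K] [Algebra O K] {ℓ : ℕ}
    (U : Submodule K (Fin ℓ → K)) : IsNoetherian O (latL O U) := by
  let R : Submodule O (Fin ℓ → K) :=
    LinearMap.range (LinearMap.pi fun i => (Algebra.linearMap O K).comp (LinearMap.proj i) :
      (Fin ℓ → O) →ₗ[O] (Fin ℓ → K))
  refine isNoetherian_of_le (t := R) ?_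
  rintro x ⟨-, hx⟩
  choose r hr using (piMap_eq_zero_iff x).1 hx
  exact ⟨r, funext hr⟩

lemma latL_finrank {O K : Type*} [CommRing O] [IsDomain O]
    [Field K] [Algebra O K] [IsFractionRing O K] {ℓ : ℕ}
    (U : Submodule K (Fin ℓ → K)) : Module.finrank O (latL O U) = Module.finrank K U := by
  rw [IsFractionRing.finrank_right_eq O K U]
  let f : latL O U →ₗ[O] U :=
    { toFun := fun x => ⟨x.1, x.2.1⟩
      map_add' := fun _ _ => rfl
      map_smul' := fun _ _ => rfl }
  haveI : IsLocalizedModule (nonZeroDivisors O) f := by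
    refine ⟨fun x => ?_, fun y => ?_, fun {x₁ x₂} h => ⟨1, ?_⟩⟩
    · have hx : algebraMap O K x ≠ 0 := by
        simpa using nonZeroDivisors.coe_ne_zero x
      rw [Module.End.isUnit_iff]
      constructor
      · intro u v huv
        have : algebraMap O K x • u = algebraMap O K x • v := by
          simpa [algebraMap_smul] using huv
        exact smul_right_injective _ hx this
      · intro u
        refine ⟨(algebraMap O K x)⁻¹ • u, ?_⟩
        rw [Module.algebraMap_end_apply, ← algebraMap_smul K, smul_smul, mul_inv_cancel₀ hx,
          one_smul]
    · obtain ⟨b, hb⟩ := IsLocalization.exist_integer_multiples_of_finite (nonZeroDivisors O) y.1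
      refine ⟨⟨⟨(b : O) • y.1, ?_, ?_⟩, b⟩, rfl⟩
      · exact (U.restrictScalars O).smul_mem _ y.2
      · exact (piMap_eq_zero_iff _).2 hb
    · have : x₁ = x₂ := Subtype.ext (congrArg (fun z : U => z.1) h)
      rw [this]
  exact (IsLocalizedModule.finrank_eq (nonZeroDivisors O) f le_rfl).symm

lemma card_eq_of_ker {R M N P : Type*} [CommRing R] [AddCommGroup M] [AddCommGroup N]
    [AddCommGroup P] [Module R M] [Module R N] [Module R P] (g : M →ₗ[R] N) (q : M →ₗ[R] P)
    (hg : Function.Surjective g) (hq : Function.Surjective q) (h : ∀ x, g x = 0 ↔ q x = 0) :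
    Nat.card N = Nat.card P := by
  have hker : LinearMap.ker g = LinearMap.ker q := by
    ext x
    rw [LinearMap.mem_ker, LinearMap.mem_ker, h]
  exact Nat.card_congr (((g.quotKerEquivOfSurjective hg).symm.trans
    (Submodule.quotEquivOfEq (LinearMap.ker g) (LinearMap.ker q) hker)).trans
    (q.quotKerEquivOfSurjective hq)).toEquiv

set_option maxHeartbeats 1000000 in
/-- For a residually finite PID `O` with fraction field `K`, a nonzero `a ∈ O`, and a
`K`-subspace `U ⊆ K^ℓ`, the cardinality of `π(U)[a]` equals `N(⟨a⟩)^{dim_K U}`. -/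
theorem stmt3 {O K : Type*} [CommRing O] [IsDomain O] [IsPrincipalIdealRing O]
    [Field K] [Algebra O K] [IsFractionRing O K]
    (hres : ∀ I : Ideal O, I ≠ ⊥ → Finite (O ⧸ I))
    (ℓ : ℕ) (a : O) (ha : a ≠ 0) (U : Submodule K (Fin ℓ → K)) :
    Nat.card (Submodule.torsionBy O (piU O U) a) =
      Nat.card (O ⧸ Ideal.span {a}) ^ Module.finrank K U := by
  have hK : algebraMap O K a ≠ 0 := by simpa using ha
  have := latL_noeth (O := O) U
  have : Module.IsTorsionFree O K := Module.IsTorsionFree.of_smul_eq_zero (fun r x h => by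
    rw [Algebra.smul_def, mul_eq_zero] at h
    simpa using h)
  let b := Module.finBasis O (latL O U)
  rw [← latL_finrank (O := O) U]
  let c : K := (algebraMap O K a)⁻¹
  have hac : ∀ x : Fin ℓ → K, a • c • x = x := fun x => by
    rw [← algebraMap_smul K, smul_smul, mul_inv_cancel₀ hK, one_smul]
  let g0 : (latL O U) →ₗ[O] (Fin ℓ → K ⧸ OinK O K) :=
    (piMap O K ℓ).comp ((c • (LinearMap.id : (Fin ℓ → K) →ₗ[O] (Fin ℓ → K))).comp (latL O U).subtype)
  have hg0 : ∀ x, g0 x = piMap O K ℓ (c • x.1) := fun _ => rfl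
  let g1 : (latL O U) →ₗ[O] piU O U := g0.codRestrict _ fun x =>
    ⟨c • x.1, U.smul_mem _ x.2.1, rfl⟩
  let g : (latL O U) →ₗ[O] Submodule.torsionBy O (piU O U) a := g1.codRestrict _ fun x => by
    rw [Submodule.mem_torsionBy_iff]
    apply Subtype.ext
    change a • piMap O K ℓ (c • x.1) = 0
    rw [← map_smul, hac]
    exact x.2.2
  have hgs : Function.Surjective g := by
    rintro ⟨⟨t, u, hu, rfl⟩, ht⟩
    have ht' : a • piMap O K ℓ u = 0 := congrArg Subtype.val ((Submodule.mem_torsionBy_iff _ _).1 ht)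
    rw [← map_smul] at ht'
    refine ⟨⟨a • u, (U.restrictScalars O).smul_mem _ hu, ht'⟩, ?_⟩
    apply Subtype.ext
    apply Subtype.ext
    change piMap O K ℓ (c • a • u) = piMap O K ℓ u
    rw [smul_comm, hac]
  have hgk : ∀ x, g x = 0 ↔ ∃ y, x = a • y := by
    intro x
    have h1 : g x = 0 ↔ piMap O K ℓ (c • x.1) = 0 := by
      rw [Subtype.ext_iff, Subtype.ext_iff]; rfl
    rw [h1]
    constructor
    · intro h
      exact ⟨⟨c • x.1, U.smul_mem _ x.2.1, h⟩, Subtype.ext (hac x.1).symm⟩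
    · rintro ⟨y, rfl⟩
      change piMap O K ℓ (c • a • y.1) = 0
      rw [smul_comm, hac]
      exact y.2.2
  let q : (latL O U) →ₗ[O] (Fin (Module.finrank O (latL O U)) → O ⧸ Ideal.span {a}) :=
    (LinearMap.pi fun i => (Ideal.span {a}).mkQ.comp (LinearMap.proj i)).comp
      b.equivFun.toLinearMap
  have hqs : Function.Surjective q := by
    intro t
    choose r hr using fun i => Submodule.mkQ_surjective (Ideal.span {a}) (t i)
    refine ⟨b.equivFun.symm r, ?_⟩
    funext i
    change (Ideal.span {a}).mkQ (b.equivFun (b.equivFun.symm r) i) = t i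
    rw [LinearEquiv.apply_symm_apply, hr]
  have hqk : ∀ x, q x = 0 ↔ ∃ y, x = a • y := by
    intro x
    have h1 : q x = 0 ↔ ∀ i, a ∣ b.equivFun x i := by
      rw [funext_iff]
      refine forall_congr' fun i => ?_
      change (Ideal.span {a}).mkQ (b.equivFun x i) = 0 ↔ _
      rw [Submodule.mkQ_apply, Submodule.Quotient.mk_eq_zero, Ideal.mem_span_singleton]
    rw [h1]
    constructor
    · intro h
      choose r hr using h
      refine ⟨b.equivFun.symm r, b.equivFun.injective ?_⟩
      rw [map_smul, LinearEquiv.apply_symm_apply]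
      exact funext hr
    · rintro ⟨y, rfl⟩ i
      rw [map_smul]
      exact ⟨_, rfl⟩
  rw [card_eq_of_ker g q hgs hqs fun x => (hgk x).trans (hqk x).symm, Nat.card_fun, Nat.card_fin]
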